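/- Every ℝ-linear isometry T : ℍ → ℍ of the quaternions (with the norm making ℍ ≅ ℝ⁴ Euclidean) whose determinant as a linear map on ℝ⁴ equals 1 is of the form T(x) = p * x * q⁻¹ for some unit quaternions p and q. In other words, the homomorphism Sp(1) × Sp(1) → SO(4), (p,q) ↦ (x ↦ p x q⁻¹), is surjective. -/

import Mathlib

open scoped Quaternion

namespace Quaternion

/-- The reflection of `ℍ` in the hyperplane orthogonal to a unit quaternion `u` is `x ↦ -u x̄ u`. -/
theorem reflection_orthogonal_span_singleton {u : ℍ[ℝ]} (hu : ‖u‖ = 1) (x : ℍ[ℝ]) :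
    (ℝ ∙ u)ᗮ.reflection x = -(u * star x * u) := by
  have hu' : star u * u = 1 := by
    rw [star_mul_self, normSq_eq_norm_mul_self, hu]; simp
  have h : x * star u + u * star x = ((2 * inner ℝ x u : ℝ) : ℍ[ℝ]) := by
    have := self_add_star (x * star u)
    rw [star_mul, star_star] at this
    rw [this, inner_def]; push_cast; rfl
  have h' : x + u * star x * u = (2 * inner ℝ x u : ℝ) • u := by
    rw [← coe_mul_eq_smul, ← h, add_mul, mul_assoc x, hu', mul_one]
  rw [Submodule.reflection_orthogonal_apply, Submodule.reflection_singleton_apply, hu,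
    real_inner_comm, eq_sub_of_add_eq' h', RCLike.ofReal_one, one_pow, div_one, two_mul, add_smul,
    two_nsmul]

theorem det_reflection_orthogonal_span_singleton {u : ℍ[ℝ]} (hu : u ≠ 0) :
    LinearMap.det (ℝ ∙ u)ᗮ.reflection.toLinearMap = -1 := by
  rw [Submodule.det_reflection, Submodule.orthogonal_orthogonal, finrank_span_singleton hu, pow_one]

/-- Every product of hyperplane reflections of `ℍ` is `x ↦ p x q` or `x ↦ p x̄ q` for unit
quaternions `p` and `q`, according to its determinant. -/
theorem exists_prod_reflection_eq (l : List ℍ[ℝ]) :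
    ∃ p q : ℍ[ℝ], ‖p‖ = 1 ∧ ‖q‖ = 1 ∧
      (LinearMap.det (l.map fun v ↦ (ℝ ∙ v)ᗮ.reflection).prod.toLinearMap = 1 ∧
          (∀ x, (l.map fun v ↦ (ℝ ∙ v)ᗮ.reflection).prod x = p * x * q) ∨
        LinearMap.det (l.map fun v ↦ (ℝ ∙ v)ᗮ.reflection).prod.toLinearMap = -1 ∧
          ∀ x, (l.map fun v ↦ (ℝ ∙ v)ᗮ.reflection).prod x = p * star x * q) := by
  induction l with
  | nil =>
    refine ⟨1, 1, norm_one, norm_one, Or.inl ⟨LinearMap.det_id, fun x ↦ ?_⟩⟩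
    simp
  | cons v l ih =>
    simp only [List.map_cons, List.prod_cons]
    generalize (l.map fun v ↦ (ℝ ∙ v)ᗮ.reflection).prod = φ at ih ⊢
    obtain rfl | hv := eq_or_ne v 0
    · have h : (ℝ ∙ (0 : ℍ[ℝ]))ᗮ.reflection = 1 := by
        ext1 x
        exact Submodule.reflection_mem_subspace_eq_self (by simp)
      rwa [h, one_mul]
    set u : ℍ[ℝ] := ‖v‖⁻¹ • v
    have hu : ‖u‖ = 1 := norm_smul_inv_norm hv
    have hs : (ℝ ∙ v) = ℝ ∙ u :=
      (Submodule.span_singleton_smul_eq (IsUnit.mk0 _ (inv_ne_zero (norm_ne_zero_iff.2 hv))) v).symm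
    have hdet : LinearMap.det ((ℝ ∙ u)ᗮ.reflection * φ).toLinearMap =
        -LinearMap.det φ.toLinearMap := by
      rw [← neg_one_mul, ← det_reflection_orthogonal_span_singleton
        (norm_ne_zero_iff.1 (hu.trans_ne one_ne_zero)), ← LinearMap.det_comp]
      rfl
    obtain ⟨p, q, hp, hq, h⟩ := ih
    simp only [hs]
    refine ⟨-(u * star q), star p * u, by simp [hu, hq], by simp [hu, hp], ?_⟩
    rw [hdet]
    refine h.symm.imp (And.imp (fun h ↦ by rw [h, neg_neg]) fun h x ↦ ?_)
      (And.imp (fun h ↦ by rw [h]) fun h x ↦ ?_) <;>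
    · rw [LinearIsometryEquiv.coe_mul, Function.comp_apply, h,
        reflection_orthogonal_span_singleton hu]
      simp [mul_assoc]

end Quaternion

/-- Every `ℝ`-linear isometry `T : ℍ → ℍ` with determinant `1`
(i.e. every element of `SO(4)`) has the form `T x = p * x * q⁻¹` for some unit
quaternions `p, q`; so `Sp(1) × Sp(1) → SO(4)` is surjective. -/
theorem spin4_cover_surjective (T : Quaternion ℝ →ₗ[ℝ] Quaternion ℝ)
    (hT : ∀ x : Quaternion ℝ, ‖T x‖ = ‖x‖) (hdet : LinearMap.det T = 1) :
    ∃ p q : Quaternion ℝ, ‖p‖ = 1 ∧ ‖q‖ = 1 ∧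
      ∀ x : Quaternion ℝ, T x = p * x * q⁻¹ := by
  let φ : Quaternion ℝ ≃ₗᵢ[ℝ] Quaternion ℝ :=
    LinearIsometry.toLinearIsometryEquiv ⟨T, hT⟩ rfl
  obtain ⟨l, -, hl⟩ := φ.reflections_generate_dim
  have hφ : φ.toLinearMap = T := rfl
  obtain ⟨p, q, hp, hq, h⟩ := Quaternion.exists_prod_reflection_eq l
  rw [← hl, hφ, hdet] at h
  obtain ⟨-, h⟩ | ⟨h, -⟩ := h
  · exact ⟨p, q⁻¹, hp, by rw [norm_inv, hq, inv_one], fun x ↦ by rw [inv_inv]; exact h x⟩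
  · norm_num at h
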